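/- arXiv:1305.2760 — 2 statements merged into one kernel-verified Lean document; each statement's English description precedes it below -/
import Mathlib

section
/- Let X and Y be nonempty compact convex subsets of a normed linear space E. Then the sets X_0 = {x ∈ X : d(x,y) = d(X,Y) for some y ∈ Y} and Y_0 = {y ∈ Y : d(x,y) = d(X,Y) for some x ∈ X} are both nonempty, compact and convex. -/
open Set Topology MeasureTheory

/-- A correspondence `T` is lower semicontinuous at a point `x`. -/
def LSCorrAt {α β : Type*} [TopologicalSpace α] [TopologicalSpace β]
    (T : α → Set β) (x : α) : Prop :=
  ∀ V : Set β, IsOpen V → (T x ∩ V).Nonempty →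
    ∃ U : Set α, IsOpen U ∧ x ∈ U ∧ ∀ y ∈ U, (T y ∩ V).Nonempty

/-- A correspondence `T` is lower semicontinuous. -/
def LSCorr {α β : Type*} [TopologicalSpace α] [TopologicalSpace β]
    (T : α → Set β) : Prop :=
  ∀ x, LSCorrAt T x

/-- A correspondence `T` is upper semicontinuous at a point `x`. -/
def USCorrAt {α β : Type*} [TopologicalSpace α] [TopologicalSpace β]
    (T : α → Set β) (x : α) : Prop :=
  ∀ V : Set β, IsOpen V → T x ⊆ V →
    ∃ U : Set α, IsOpen U ∧ x ∈ U ∧ ∀ y ∈ U, T y ⊆ V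

/-- A correspondence `T` is upper semicontinuous. -/
def USCorr {α β : Type*} [TopologicalSpace α] [TopologicalSpace β]
    (T : α → Set β) : Prop :=
  ∀ x, USCorrAt T x

/-- The graph of a correspondence. -/
def corrGraph {α β : Type*} (T : α → Set β) : Set (α × β) := {p | p.2 ∈ T p.1}

/-- The correspondence `T̄` whose graph is the closure of the graph of `T`. -/
def corrBar {α β : Type*} [TopologicalSpace α] [TopologicalSpace β]
    (T : α → Set β) : α → Set β :=
  fun x => {y | (x, y) ∈ closure (corrGraph T)}

/-- `s` is relatively open in `Y`. -/
def RelOpenIn {E : Type*} [TopologicalSpace E] (Y s : Set E) : Prop :=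
  ∃ V : Set E, IsOpen V ∧ s = V ∩ Y

/-- The distance `d(X,Y) = inf {d(x,y) : x ∈ X, y ∈ Y}` between two sets. -/
noncomputable def setDist {E : Type*} [PseudoMetricSpace E] (X Y : Set E) : ℝ :=
  sInf ((fun p : E × E => dist p.1 p.2) '' (X ×ˢ Y))

/-- The set `X^0` of points of `X` realizing the distance to each `Y i`. -/
def X0set {E : Type*} [PseudoMetricSpace E] {ι : Type*} (X : Set E) (Y : ι → Set E) : Set E :=
  {x ∈ X | ∀ i, ∃ y ∈ Y i, dist x y = setDist X (Y i)}

/-- The set `Y_i^0` of points of `Y_i` realizing the distance to `X`. -/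
def Y0set {E : Type*} [PseudoMetricSpace E] (X Yi : Set E) : Set E :=
  {y ∈ Yi | ∃ x ∈ X, dist x y = setDist X Yi}

/-- The product set `∏ᵢ Yᵢ` inside the pi type. -/
def PiSet {E : Type*} {ι : Type*} (Y : ι → Set E) : Set (ι → E) := {y | ∀ i, y i ∈ Y i}

/-- `Tx` is a `Q_θ`-majorant of `T` at `x` (values relatively open in `Y`). -/
def IsQMajorant {α E : Type*} [TopologicalSpace α] [TopologicalSpace E]
    [AddCommGroup E] [Module ℝ E]
    (Y : Set E) (θ : α → E) (T Tx : α → Set E) (x : α) : Prop :=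
  (∃ N : Set α, IsOpen N ∧ x ∈ N ∧ ∀ z ∈ N, T z ⊆ Tx z ∧ θ z ∉ closure (Tx z)) ∧
    LSCorr Tx ∧ ∀ z, RelOpenIn Y (Tx z) ∧ Convex ℝ (Tx z)

/-- `T` is `Q_θ`-majorized. -/
def QMajorized {α E : Type*} [TopologicalSpace α] [TopologicalSpace E]
    [AddCommGroup E] [Module ℝ E]
    (Y : Set E) (θ : α → E) (T : α → Set E) : Prop :=
  ∀ x, (T x).Nonempty → ∃ Tx : α → Set E, IsQMajorant Y θ T Tx x

/-- `Tx` is a `Q'_θ`-majorant of `T` at `x`. -/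
def IsQ'Majorant {α E : Type*} [TopologicalSpace α] [TopologicalSpace E]
    [AddCommGroup E] [Module ℝ E]
    (Y : Set E) (θ : α → E) (T Tx : α → Set E) (x : α) : Prop :=
  (∃ N : Set α, IsOpen N ∧ x ∈ N ∧ ∀ z ∈ N, T z ⊆ Tx z ∧ θ z ∉ corrBar Tx z) ∧
    LSCorr Tx ∧ ∀ z, RelOpenIn Y (Tx z) ∧ Convex ℝ (Tx z)

/-- `T` is `Q'_θ`-majorized. -/
def Q'Majorized {α E : Type*} [TopologicalSpace α] [TopologicalSpace E]
    [AddCommGroup E] [Module ℝ E]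
    (Y : Set E) (θ : α → E) (T : α → Set E) : Prop :=
  ∀ x, (T x).Nonempty → ∃ Tx : α → Set E, IsQ'Majorant Y θ T Tx x

/-- The `a`-cut of a fuzzy set `A` on `Yi`. -/
def fuzzyCut {E : Type*} (Yi : Set E) (A : E → ℝ) (a : ℝ) : Set E := {z ∈ Yi | a ≤ A z}

/-- A family of sets is a Suslin family if it is closed under the Suslin operation. -/
def IsSuslinFamily {Ω : Type*} (F : Set (Set Ω)) : Prop :=
  ∀ A : List ℕ → Set Ω, (∀ s, A s ∈ F) →
    (⋃ σ : ℕ → ℕ, ⋂ k : ℕ, A ((List.range k).map σ)) ∈ F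

/-- A topological space is a Suslin space if it is a continuous image of a Polish space. -/
def IsSuslinSpace (α : Type*) [TopologicalSpace α] : Prop :=
  ∃ (β : Type) (tβ : TopologicalSpace β), @PolishSpace β tβ ∧
    ∃ f : β → α, @Continuous β α tβ _ f ∧ Function.Surjective f

theorem setDist_le_dist {E : Type*} [PseudoMetricSpace E] {X Y : Set E} {x y : E}
    (hx : x ∈ X) (hy : y ∈ Y) : setDist X Y ≤ dist x y :=
  csInf_le ⟨0, by rintro _ ⟨p, -, rfl⟩; exact dist_nonneg⟩ ⟨(x, y), ⟨hx, hy⟩, rfl⟩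

/-- The set of pairs in `X ×ˢ Y` at distance at most `setDist X Y`. -/
def proximalPairs {E : Type*} [PseudoMetricSpace E] (X Y : Set E) : Set (E × E) :=
  {p ∈ X ×ˢ Y | dist p.1 p.2 ≤ setDist X Y}

theorem proximalPairs_nonempty {E : Type*} [PseudoMetricSpace E] {X Y : Set E}
    (hXne : X.Nonempty) (hXcp : IsCompact X) (hYne : Y.Nonempty) (hYcp : IsCompact Y) :
    (proximalPairs X Y).Nonempty := by
  obtain ⟨p, hp, h, -⟩ := (hXcp.prod hYcp).exists_sInf_image_eq_and_le (hXne.prod hYne)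
    (f := fun p : E × E => dist p.1 p.2) continuous_dist.continuousOn
  exact ⟨p, hp, h.ge⟩

theorem isCompact_proximalPairs {E : Type*} [PseudoMetricSpace E] {X Y : Set E}
    (hXcp : IsCompact X) (hYcp : IsCompact Y) : IsCompact (proximalPairs X Y) :=
  (hXcp.prod hYcp).inter_right (isClosed_le continuous_dist continuous_const)

theorem convex_proximalPairs {E : Type*} [SeminormedAddCommGroup E] [NormedSpace ℝ E]
    {X Y : Set E} (hXcv : Convex ℝ X) (hYcv : Convex ℝ Y) :
    Convex ℝ (proximalPairs X Y) :=
  by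
  have hdist : ConvexOn ℝ univ fun p : E × E => dist p.1 p.2 := by
    simp only [dist_eq_norm]
    exact
      (convexOn_univ_norm (E := E)).comp_linearMap (LinearMap.fst ℝ E E - LinearMap.snd ℝ E E)
  exact (hdist.subset (subset_univ _) (hXcv.prod hYcv)).convex_le _

theorem fst_image_proximalPairs {E : Type*} [PseudoMetricSpace E] (X Y : Set E) :
    Prod.fst '' proximalPairs X Y = {x ∈ X | ∃ y ∈ Y, dist x y = setDist X Y} := by
  ext x
  constructor
  · rintro ⟨p, ⟨⟨hx, hy⟩, h⟩, rfl⟩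
    exact ⟨hx, p.2, hy, h.antisymm (setDist_le_dist hx hy)⟩
  · rintro ⟨hx, y, hy, h⟩
    exact ⟨(x, y), ⟨⟨hx, hy⟩, h.le⟩, rfl⟩

theorem snd_image_proximalPairs {E : Type*} [PseudoMetricSpace E] (X Y : Set E) :
    Prod.snd '' proximalPairs X Y = {y ∈ Y | ∃ x ∈ X, dist x y = setDist X Y} := by
  ext y
  constructor
  · rintro ⟨p, ⟨⟨hx, hy⟩, h⟩, rfl⟩
    exact ⟨hy, p.1, hx, h.antisymm (setDist_le_dist hx hy)⟩
  · rintro ⟨hy, x, hx, h⟩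
    exact ⟨(x, y), ⟨⟨hx, hy⟩, h.le⟩, rfl⟩

/-- for nonempty compact convex `X, Y` in a normed space, the proximal
sets `X₀` and `Y₀` are nonempty, compact and convex. -/
theorem proximal_sets_nonempty_compact_convex
    {E : Type*} [NormedAddCommGroup E] [NormedSpace ℝ E]
    (X Y : Set E)
    (hXne : X.Nonempty) (hXcp : IsCompact X) (hXcv : Convex ℝ X)
    (hYne : Y.Nonempty) (hYcp : IsCompact Y) (hYcv : Convex ℝ Y) :
    ({x ∈ X | ∃ y ∈ Y, dist x y = setDist X Y}.Nonempty ∧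
      IsCompact {x ∈ X | ∃ y ∈ Y, dist x y = setDist X Y} ∧
      Convex ℝ {x ∈ X | ∃ y ∈ Y, dist x y = setDist X Y}) ∧
    ({y ∈ Y | ∃ x ∈ X, dist x y = setDist X Y}.Nonempty ∧
      IsCompact {y ∈ Y | ∃ x ∈ X, dist x y = setDist X Y} ∧
      Convex ℝ {y ∈ Y | ∃ x ∈ X, dist x y = setDist X Y}) := by
  have hne := proximalPairs_nonempty hXne hXcp hYne hYcp
  have hcp := isCompact_proximalPairs hXcp hYcp
  have hcv := convex_proximalPairs hXcv hYcv
  rw [← fst_image_proximalPairs, ← snd_image_proximalPairs]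
  exact ⟨⟨hne.image _, hcp.image continuous_fst, hcv.linear_image (LinearMap.fst ℝ E E)⟩,
    ⟨hne.image _, hcp.image continuous_snd, hcv.linear_image (LinearMap.snd ℝ E E)⟩⟩
end

section
/- Let E be a normed linear space with dual E′, let Y_i be a nonempty convex subset of E, let y* ∈ Y_i and z ∈ Y_i, and for λ ∈ [0,1] set z_λ = λz + (1−λ)y*, with L = {z_λ : λ ∈ [0,1]} ⊆ Y_i. Let G : L → 2^{E′} be a correspondence with nonempty values that is lower semicontinuous from the relative topology of L into the weak* topology σ(E′, E) of E′. If sup_{u ∈ G(z_λ)} Re⟨u, y* − z⟩ ≤ 0 for each λ ∈ (0,1], then sup_{u ∈ G(y*)} Re⟨u, y* − z⟩ ≤ 0. -/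
open Set Topology MeasureTheory

/-- the key continuity step: if `G` is lower semicontinuous on the segment
`L = {λ•z + (1-λ)•y* : λ ∈ [0,1]}` into the weak* topology, has nonempty values, and
`sup_{u ∈ G(z_λ)} ⟨u, y* − z⟩ ≤ 0` for all `λ ∈ (0,1]`, then the same holds at `y*`. -/
theorem continuity_step_monotone_gqvi
    {E : Type*} [NormedAddCommGroup E] [NormedSpace ℝ E]
    (Yi : Set E) (hYne : Yi.Nonempty) (hYcv : Convex ℝ Yi)
    (ystar z : E) (hy : ystar ∈ Yi) (hz : z ∈ Yi)
    (L : Set E)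
    (hL : L = {x : E | ∃ lam : ℝ, lam ∈ Set.Icc (0 : ℝ) 1 ∧ x = lam • z + (1 - lam) • ystar})
    (G : E → Set (WeakDual ℝ E))
    (hGne : ∀ x ∈ L, (G x).Nonempty)
    (hGlsc : LSCorr (fun p : ↥L => G (p : E)))
    (hyp : ∀ lam : ℝ, lam ∈ Set.Ioc (0 : ℝ) 1 →
      ∀ u ∈ G (lam • z + (1 - lam) • ystar), u (ystar - z) ≤ 0) :
    ∀ u ∈ G ystar, u (ystar - z) ≤ 0 := by
  intro u hu
  by_contra! hpos
  let γ : Set.Icc (0 : ℝ) 1 → L := fun t =>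
    ⟨(t : ℝ) • z + (1 - (t : ℝ)) • ystar, by rw [hL]; exact ⟨t, t.2, rfl⟩⟩
  have hγ : Continuous γ := Continuous.subtype_mk (by fun_prop) _
  have hγ0 : ((γ 0 : L) : E) = ystar := by simp [γ]
  have hV : IsOpen {v : WeakDual ℝ E | 0 < v (ystar - z)} :=
    isOpen_lt continuous_const (WeakDual.eval_continuous _)
  obtain ⟨U, hU, hmem, hUV⟩ := hGlsc (γ 0) _ hV ⟨u, by simpa only [hγ0] using hu, hpos⟩
  have hnhds : ∀ᶠ t in 𝓝[>] (0 : Set.Icc (0 : ℝ) 1), γ t ∈ U :=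
    nhdsWithin_le_nhds ((hU.preimage hγ).mem_nhds hmem)
  have : (𝓝[>] (0 : Set.Icc (0 : ℝ) 1)).NeBot :=
    nhdsGT_neBot_of_exists_gt ⟨1, zero_lt_one⟩
  obtain ⟨t, htU, ht⟩ := (hnhds.and self_mem_nhdsWithin).exists
  obtain ⟨v, hvG, hv⟩ := hUV (γ t) htU
  exact (hyp t ⟨ht, t.2.2⟩ v hvG).not_gt hv
end
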